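/- (Kuipers–Meulenbeld.) Let x ∈ (0,1) be irrational and suppose a_{j+1} ≥ 2 for some j ≥ 0 (with the convention a_0 := 0). If a_{j+1} ≤ a_j + 1, then Θ(x, (p_j + p_{j−1})/(q_j + q_{j−1})) < 1. If a_{j+1} ≤ a_{j+2} + 1, then Θ(x, ((a_{j+1} − 1) p_j + p_{j−1})/((a_{j+1} − 1) q_j + q_{j−1})) < 1. -/

import Mathlib

open MeasureTheory Filter Topology
open scoped Classical

noncomputable section

/-- The Farey tent map `F`. -/
def fareyMap (x : ℝ) : ℝ := if x ≤ 1/2 then x / (1 - x) else (1 - x) / x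

/-- `eps x n = ε_{n+1}(x)`, i.e. `0` if `F^[n] x ≤ 1/2` and `1` otherwise. -/
def eps (x : ℝ) (n : ℕ) : ℤ := if fareyMap^[n] x ≤ 1/2 then 0 else 1

/-- The matrices `A_0 = [[1,0],[1,1]]` and `A_1 = [[0,1],[1,1]]`. -/
def Amat (e : ℤ) : Matrix (Fin 2) (Fin 2) ℤ := !![1 - e, e; 1, 1]

/-- `Mmat x n = A_{ε_1(x)} ⋯ A_{ε_n(x)}`, with `Mmat x 0` the identity. -/
def Mmat (x : ℝ) : ℕ → Matrix (Fin 2) (Fin 2) ℤ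
  | 0 => 1
  | n + 1 => Mmat x n * Amat (eps x n)

/-- `u_n(x)`: top-left entry of `M_n(x)`. -/
def uF (x : ℝ) (n : ℕ) : ℤ := Mmat x n 0 0

/-- `s_n(x)`: bottom-left entry of `M_n(x)`. -/
def sF (x : ℝ) (n : ℕ) : ℤ := Mmat x n 1 0

/-- Ito's natural extension `F̄` of the Farey tent map. -/
def fareyNE (p : ℝ × ℝ) : ℝ × ℝ :=
  if p.1 ≤ 1/2 then (p.1 / (1 - p.1), p.2 / (1 + p.2))
  else ((1 - p.1) / p.1, 1 / (1 + p.2))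

/-- `Ω = [0,1]²`. -/
def OmegaSet : Set (ℝ × ℝ) := Set.Icc (0:ℝ) 1 ×ˢ Set.Icc (0:ℝ) 1

/-- The measure `μ̄` on `Ω` with density `(x + y − xy)⁻²` w.r.t. Lebesgue measure. -/
def muBar : Measure (ℝ × ℝ) :=
  (volume.restrict OmegaSet).withDensity
    (fun p => ENNReal.ofReal (1 / (p.1 + p.2 - p.1 * p.2) ^ 2))

/-- A proper inducible subregion of `Ω`. -/
def ProperInducible (R : Set (ℝ × ℝ)) : Prop :=
  R ⊆ OmegaSet ∧ MeasurableSet R ∧ 0 < muBar R ∧ muBar R < ⊤ ∧ muBar (frontier R) = 0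

/-- `hitsR R x k` holds iff `k ≥ 1` and `F̄^[k] (x,1) ∈ R`. -/
def hitsR (R : Set (ℝ × ℝ)) (x : ℝ) (k : ℕ) : Prop := 1 ≤ k ∧ fareyNE^[k] (x, 1) ∈ R

/-- `Nidx R x n = N_n`: `N_0 = 0` and, for `n ≥ 1`, the `n`-th smallest `k ≥ 1`
with `F̄^[k] (x,1) ∈ R`. -/
def Nidx (R : Set (ℝ × ℝ)) (x : ℝ) : ℕ → ℕ
  | 0 => 0
  | n + 1 => Nat.nth (hitsR R x) n

/-- `h(x,y) = (1−y)/(x + y − xy)`. -/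
def hIto (p : ℝ × ℝ) : ℝ := (1 - p.2) / (p.1 + p.2 - p.1 * p.2)

/-- `Θ_n(x) = s_n(x)·|s_n(x)·x − u_n(x)|`, the approximation coefficient of the
`n`-th Farey convergent `u_n(x)/s_n(x)`. -/
def ThetaF (x : ℝ) (n : ℕ) : ℝ := (sF x n : ℝ) * |(sF x n : ℝ) * x - (uF x n : ℝ)|

/-- `Θ_n^R(x) = s_n^R·|s_n^R·x − u_n^R|` where `u_n^R = u_{N_n}(x)`, `s_n^R = s_{N_n}(x)`. -/
def ThetaR (R : Set (ℝ × ℝ)) (x : ℝ) (n : ℕ) : ℝ := ThetaF x (Nidx R x n)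

/-- The Gauss map. -/
def gaussMap (x : ℝ) : ℝ := Int.fract (1 / x)

/-- `pquot x n` is the RCF partial quotient `a_{n+1}(x)`. -/
def pquot (x : ℝ) (n : ℕ) : ℤ := ⌊1 / (gaussMap^[n] x)⌋

/-- `pnum x (j+1)` is the RCF numerator `p_j(x)`; `pnum x 0 = p_{-1} = 1`. -/
def pnum (x : ℝ) : ℕ → ℤ
  | 0 => 1
  | 1 => 0
  | n + 2 => pquot x n * pnum x (n + 1) + pnum x n

/-- `qden x (j+1)` is the RCF denominator `q_j(x)`; `qden x 0 = q_{-1} = 0`. -/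
def qden (x : ℝ) : ℕ → ℤ
  | 0 => 0
  | 1 => 1
  | n + 2 => pquot x n * qden x (n + 1) + qden x n

/-- The approximation coefficient `Θ(x, p/q) = q·|q·x − p|`. -/
def Theta (x : ℝ) (p q : ℤ) : ℝ := (q : ℝ) * |(q : ℝ) * x - (p : ℝ)|

/-- `medTheta x l j = Θ(x, (l·p_j + p_{j−1})/(l·q_j + q_{j−1}))`. -/
def medTheta (x : ℝ) (l : ℤ) (j : ℕ) : ℝ :=
  Theta x (l * pnum x (j + 1) + pnum x j) (l * qden x (j + 1) + qden x j)

end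

theorem gaussMap_iterate_irrational {x : ℝ} (hirr : Irrational x) (n : ℕ) :
    Irrational (gaussMap^[n] x) := by
  induction n with
  | zero => simpa using hirr
  | succ n ih =>
    rw [Function.iterate_succ_apply', gaussMap, one_div, Int.fract]
    exact ih.inv.sub_intCast _

theorem gaussMap_iterate_mem_Ioo {x : ℝ} (hx : x ∈ Set.Ioo (0:ℝ) 1) (hirr : Irrational x)
    (n : ℕ) : gaussMap^[n] x ∈ Set.Ioo (0:ℝ) 1 := by
  cases n with
  | zero => simpa using hx
  | succ n =>
    have hne := (gaussMap_iterate_irrational hirr (n + 1)).ne_zero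
    rw [Function.iterate_succ_apply', gaussMap] at hne ⊢
    exact ⟨lt_of_le_of_ne (Int.fract_nonneg _) hne.symm, Int.fract_lt_one _⟩

theorem pquot_add_mul_gaussMap_iterate {x : ℝ} (hx : x ∈ Set.Ioo (0:ℝ) 1) (hirr : Irrational x)
    (n : ℕ) : (pquot x n + gaussMap^[n + 1] x) * gaussMap^[n] x = 1 := by
  have h0 := (gaussMap_iterate_mem_Ioo hx hirr n).1
  rw [Function.iterate_succ_apply', gaussMap, pquot, Int.floor_add_fract]
  field_simp

theorem one_le_pquot {x : ℝ} (hx : x ∈ Set.Ioo (0:ℝ) 1) (hirr : Irrational x) (n : ℕ) :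
    1 ≤ pquot x n := by
  obtain ⟨h0, h1⟩ := gaussMap_iterate_mem_Ioo hx hirr n
  rw [pquot, Int.le_floor, Int.cast_one, le_div_iff₀ h0]
  linarith

theorem qden_pos {x : ℝ} (hx : x ∈ Set.Ioo (0:ℝ) 1) (hirr : Irrational x) (n : ℕ) :
    0 ≤ qden x n ∧ qden x n ≤ qden x (n + 1) ∧ 1 ≤ qden x (n + 1) := by
  induction n with
  | zero => simp [qden]
  | succ n ih =>
    obtain ⟨h0, _, h1⟩ := ih
    have ha := one_le_pquot hx hirr n
    have hle : qden x (n + 1) ≤ qden x (n + 2) := by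
      rw [qden]
      nlinarith
    exact ⟨by lia, hle, by lia⟩

theorem qden_mul_sub_pnum_succ {x : ℝ} (hx : x ∈ Set.Ioo (0:ℝ) 1) (hirr : Irrational x) (n : ℕ) :
    (qden x (n + 1) : ℝ) * x - pnum x (n + 1) =
      -gaussMap^[n] x * (qden x n * x - pnum x n) := by
  induction n with
  | zero => simp [qden, pnum]
  | succ n ih =>
    have h := pquot_add_mul_gaussMap_iterate hx hirr n
    rw [qden, pnum]
    push_cast
    linear_combination (pquot x n + gaussMap^[n + 1] x) * ih -
      ((qden x n : ℝ) * x - pnum x n) * h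

theorem abs_qden_mul_sub_pnum_mul {x : ℝ} (hx : x ∈ Set.Ioo (0:ℝ) 1) (hirr : Irrational x)
    (n : ℕ) :
    |(qden x n : ℝ) * x - pnum x n| * (qden x (n + 1) + qden x n * gaussMap^[n] x) = 1 := by
  induction n with
  | zero => simp [qden, pnum]
  | succ n ih =>
    have h := pquot_add_mul_gaussMap_iterate hx hirr n
    rw [qden_mul_sub_pnum_succ hx hirr, abs_mul, abs_neg,
      abs_of_pos (gaussMap_iterate_mem_Ioo hx hirr n).1, qden]
    push_cast
    linear_combination ih + |(qden x n : ℝ) * x - pnum x n| * qden x (n + 1) * h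

/-- The approximation coefficient of a mediant in terms of the natural extension coordinates. -/
theorem medTheta_eq {x : ℝ} (hx : x ∈ Set.Ioo (0:ℝ) 1) (hirr : Irrational x) (l : ℤ) (j : ℕ)
    (hl : l * gaussMap^[j] x ≤ 1) :
    medTheta x l j = (l * qden x (j + 1) + qden x j) * (1 - l * gaussMap^[j] x) /
      (qden x (j + 1) + qden x j * gaussMap^[j] x) := by
  have hD := abs_qden_mul_sub_pnum_mul hx hirr j
  have hne := right_ne_zero_of_mul_eq_one hD
  have hmed : ((l * qden x (j + 1) + qden x j : ℤ) : ℝ) * x -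
      ((l * pnum x (j + 1) + pnum x j : ℤ) : ℝ) =
      (1 - l * gaussMap^[j] x) * (qden x j * x - pnum x j) := by
    push_cast
    linear_combination (l : ℝ) * qden_mul_sub_pnum_succ hx hirr j
  rw [medTheta, Theta, hmed, abs_mul, abs_of_nonneg (by linarith), eq_div_iff hne]
  push_cast
  linear_combination (l * qden x (j + 1) + qden x j) * (1 - l * gaussMap^[j] x) * hD

/-- Kuipers–Meulenbeld: with the convention `a_0 = 0`, if `a_{j+1} ≥ 2` and
`a_{j+1} ≤ a_j + 1` then the first mediant has `Θ < 1`; if `a_{j+1} ≤ a_{j+2} + 1`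
then the final mediant has `Θ < 1`. -/
theorem stmt_13 (x : ℝ) (hx : x ∈ Set.Ioo (0:ℝ) 1) (hirr : Irrational x)
    (j : ℕ) (hj : 2 ≤ pquot x j) :
    ((pquot x j ≤ (if j = 0 then 0 else pquot x (j - 1)) + 1) → medTheta x 1 j < 1) ∧
    ((pquot x j ≤ pquot x (j + 1) + 1) → medTheta x (pquot x j - 1) j < 1) := by
  obtain ⟨ht0, ht1⟩ := gaussMap_iterate_mem_Ioo hx hirr j
  obtain ⟨hs0, hs1⟩ := gaussMap_iterate_mem_Ioo hx hirr (j + 1)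
  obtain ⟨hu0, _⟩ := gaussMap_iterate_mem_Ioo hx hirr (j + 2)
  have ht := pquot_add_mul_gaussMap_iterate hx hirr j
  have hs := pquot_add_mul_gaussMap_iterate hx hirr (j + 1)
  obtain ⟨hQ0, hQ, hQ1⟩ := qden_pos hx hirr j
  have hj' : (2:ℝ) ≤ pquot x j := by exact_mod_cast hj
  have hQ0' : (0:ℝ) ≤ qden x j := by exact_mod_cast hQ0
  have hQ' : (qden x j : ℝ) ≤ qden x (j + 1) := by exact_mod_cast hQ
  have hQ1' : (1:ℝ) ≤ qden x (j + 1) := by exact_mod_cast hQ1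
  have hden : 0 < qden x (j + 1) + qden x j * gaussMap^[j] x := by positivity
  constructor
  · intro h
    rw [medTheta_eq hx hirr _ _ (by push_cast; linarith), div_lt_one hden]
    obtain _ | k := j
    · simp at h
      lia
    simp only [Nat.add_eq_zero_iff, one_ne_zero, and_false, if_false, Nat.add_sub_cancel] at h
    have hle : (pquot x (k + 1) - 1) * qden x (k + 1) ≤ qden x (k + 2) := by
      rw [qden]
      nlinarith [(qden_pos hx hirr k).1]
    have hle' : ((pquot x (k + 1) : ℝ) - 1) * qden x (k + 1) ≤ qden x (k + 2) := by
      exact_mod_cast hle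
    have hq : (1:ℝ) ≤ qden x (k + 1) := by exact_mod_cast (qden_pos hx hirr k).2.2
    generalize gaussMap^[k + 1] x = t at *
    generalize gaussMap^[k + 1 + 1] x = s at *
    have hlt : (qden x (k + 1) : ℝ) * (pquot x (k + 1) + s - 2) < qden x (k + 2) := by
      nlinarith
    push_cast
    linear_combination t * hlt - qden x (k + 1) * ht
  · intro h
    have h' : (pquot x j : ℝ) ≤ pquot x (j + 1) + 1 := by exact_mod_cast h
    rw [medTheta_eq hx hirr _ _ (by push_cast; nlinarith), div_lt_one hden]
    generalize gaussMap^[j] x = t at *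
    generalize gaussMap^[j + 1] x = s at *
    generalize gaussMap^[j + 1 + 1] x = u at *
    have hlt : (pquot x j - 1) * s < 1 := by
      nlinarith
    have hlt' : ((pquot x j - 1) * qden x (j + 1) + qden x j : ℝ) * (1 + s) <
        qden x (j + 1) * (pquot x j + s) + qden x j := by
      nlinarith
    have ht' : 1 - (pquot x j - 1) * t = t * (1 + s) := by linear_combination -ht
    push_cast
    rw [ht']
    linear_combination t * hlt' + qden x (j + 1) * ht
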